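/- (Stabilization by a unimodular lattice.) Let (V', B', Λ', W₂') and (V'', B'', U, W₂ᵁ) each be a full lattice with integral symmetric nondegenerate bilinear form and characteristic vector, as in the shared setup, and assume in addition that U is unimodular (U* = U, i.e. U equals its dual lattice) and that B''(W₂ᵁ, W₂ᵁ) ∈ 8ℤ. Form the orthogonal direct sum Λ := Λ' ⊕ U ⊆ V' ⊕ V'' with bilinear form B := B' ⊕ B'' and characteristic vector W₂ := W₂' + W₂ᵁ, and assume Λ'₀ ≠ Λ'. Then there is a group isomorphism (Λ₀)*/Λ₀ ≅ (Λ'₀)*/Λ'₀ which intertwines the quadratic forms [x] ↦ ½·B(x,x) mod ℤ and [x'] ↦ ½·B'(x',x') mod ℤ and sends the fermion class of Λ/Λ₀ to the fermion class of Λ'/Λ'₀. -/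

import Mathlib

open scoped Classical

noncomputable section

/-- The group `ℚ/ℤ`. -/
abbrev QZ : Type := AddCircle (1 : ℚ)

/-- A lattice datum: a finite-dimensional ℚ-vector space `V` with a nondegenerate
symmetric bilinear form `B`, a full lattice `Λ = L` (finitely generated ℤ-submodule
spanning `V` over ℚ, on which `B` is integral), and a characteristic vector `W = W₂ ∈ Λ*`
(`B(W₂,λ) − B(λ,λ) ∈ 2ℤ` for all `λ ∈ Λ`). -/
structure LatticeDatum (V : Type*) [AddCommGroup V] [Module ℚ V] where
  B : V → V → ℚ
  B_add_left : ∀ x y z : V, B (x + y) z = B x z + B y z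
  B_smul_left : ∀ (c : ℚ) (x y : V), B (c • x) y = c * B x y
  B_symm : ∀ x y : V, B x y = B y x
  B_nondeg : ∀ x : V, (∀ y : V, B x y = 0) → x = 0
  L : Submodule ℤ V
  L_fg : L.FG
  L_full : Submodule.span ℚ (L : Set V) = ⊤
  L_int : ∀ x ∈ L, ∀ y ∈ L, ∃ n : ℤ, B x y = (n : ℚ)
  W : V
  W_dual : ∀ l ∈ L, ∃ n : ℤ, B W l = (n : ℚ)
  W_char : ∀ l ∈ L, ∃ n : ℤ, B W l - B l l = 2 * (n : ℚ)

namespace LatticeDatum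

variable {V : Type*} [AddCommGroup V] [Module ℚ V] (D : LatticeDatum V)

theorem B_zero_left (y : V) : D.B 0 y = 0 := by
  have h := D.B_add_left 0 0 y
  rw [add_zero] at h
  linarith

theorem B_neg_left (x y : V) : D.B (-x) y = - D.B x y := by
  have h := D.B_add_left x (-x) y
  rw [add_neg_cancel, D.B_zero_left] at h
  linarith

theorem B_add_right (x y z : V) : D.B x (y + z) = D.B x y + D.B x z := by
  rw [D.B_symm x (y + z), D.B_add_left, D.B_symm y x, D.B_symm z x]

theorem B_zero_right (x : V) : D.B x 0 = 0 := by
  rw [D.B_symm x 0, D.B_zero_left]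

theorem B_neg_right (x y : V) : D.B x (-y) = - D.B x y := by
  rw [D.B_symm x (-y), D.B_neg_left, D.B_symm y x]

/-- The dual of a subset `s ⊆ V` with respect to `B`:
`s* = {x ∈ V : B(x,l) ∈ ℤ for all l ∈ s}`, as a subgroup of `V`. -/
def dual (s : Set V) : AddSubgroup V where
  carrier := {x | ∀ l ∈ s, ∃ n : ℤ, D.B x l = (n : ℚ)}
  zero_mem' := fun l _ => ⟨0, by rw [D.B_zero_left]; norm_num⟩
  add_mem' := by
    intro x y hx hy l hl
    obtain ⟨n, hn⟩ := hx l hl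
    obtain ⟨m, hm⟩ := hy l hl
    exact ⟨n + m, by rw [D.B_add_left, hn, hm]; push_cast; ring⟩
  neg_mem' := by
    intro x hx l hl
    obtain ⟨n, hn⟩ := hx l hl
    exact ⟨-n, by rw [D.B_neg_left, hn]; push_cast; ring⟩

/-- The even kernel `Λ₀ = {λ ∈ Λ : B(W₂,λ) ∈ 2ℤ}`, as a subgroup of `V`. -/
def L0 : AddSubgroup V where
  carrier := {l | l ∈ D.L ∧ ∃ n : ℤ, D.B D.W l = 2 * (n : ℚ)}
  zero_mem' := ⟨D.L.zero_mem, 0, by rw [D.B_zero_right]; norm_num⟩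
  add_mem' := by
    rintro x y ⟨hxL, n, hn⟩ ⟨hyL, m, hm⟩
    exact ⟨D.L.add_mem hxL hyL, n + m, by rw [D.B_add_right, hn, hm]; push_cast; ring⟩
  neg_mem' := by
    rintro x ⟨hxL, n, hn⟩
    exact ⟨D.L.neg_mem hxL, -n, by rw [D.B_neg_right, hn]; push_cast; ring⟩

/-- The discriminant group `Λ*/Λ`. -/
abbrev disc : Type _ :=
  ↥(D.dual (D.L : Set V)) ⧸ (D.L.toAddSubgroup.addSubgroupOf (D.dual (D.L : Set V)))

/-- The projection `Λ* → Λ*/Λ`. -/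
def discProj : ↥(D.dual (D.L : Set V)) →+ D.disc := QuotientAddGroup.mk' _

/-- The group `G = (Λ₀)*/Λ₀`. -/
abbrev disc0 : Type _ :=
  ↥(D.dual (D.L0 : Set V)) ⧸ ((D.L0).addSubgroupOf (D.dual (D.L0 : Set V)))

/-- The projection `(Λ₀)* → (Λ₀)*/Λ₀`. -/
def disc0Proj : ↥(D.dual (D.L0 : Set V)) →+ D.disc0 := QuotientAddGroup.mk' _

end LatticeDatum

namespace LatticeDatum

variable {V : Type*} [AddCommGroup V] [Module ℚ V] (D : LatticeDatum V)

theorem B_smul_right (c : ℚ) (x y : V) : D.B x (c • y) = c * D.B x y := by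
  rw [D.B_symm, D.B_smul_left, D.B_symm]

theorem B_sub_left (x y z : V) : D.B (x - y) z = D.B x z - D.B y z := by
  rw [sub_eq_add_neg, D.B_add_left, D.B_neg_left, sub_eq_add_neg]

theorem B_sub_right (x y z : V) : D.B x (y - z) = D.B x y - D.B x z := by
  rw [sub_eq_add_neg, D.B_add_right, D.B_neg_right, sub_eq_add_neg]

theorem mem_L0 {l : V} : l ∈ D.L0 ↔ l ∈ D.L ∧ ∃ n : ℤ, D.B D.W l = 2 * n := Iff.rfl

theorem L0_le_L {l : V} (h : l ∈ D.L0) : l ∈ D.L := h.1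

theorem L_subset_dual_L0 {l : V} (h : l ∈ D.L) : l ∈ D.dual (D.L0 : Set V) :=
  fun m hm => D.L_int l h m hm.1

theorem even_or_odd_B_W {l : V} (h : l ∈ D.L) :
    (∃ n : ℤ, D.B D.W l = 2 * n) ∨ ∃ n : ℤ, D.B D.W l = 2 * n + 1 := by
  obtain ⟨m, hm⟩ := D.W_dual l h
  obtain ⟨k, hk | hk⟩ := Int.even_or_odd' m
  · exact Or.inl ⟨k, by rw [hm, hk]; push_cast; rfl⟩
  · exact Or.inr ⟨k, by rw [hm, hk]; push_cast; rfl⟩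

theorem odd_B_W_of_notMem_L0 {l : V} (h : l ∈ D.L) (h0 : l ∉ D.L0) :
    ∃ n : ℤ, D.B D.W l = 2 * n + 1 :=
  (D.even_or_odd_B_W h).resolve_left fun he => h0 ⟨h, he⟩

theorem sub_mem_L0_of_odd {l m : V} (hl : l ∈ D.L) (hm : m ∈ D.L)
    (hl' : ∃ n : ℤ, D.B D.W l = 2 * n + 1) (hm' : ∃ n : ℤ, D.B D.W m = 2 * n + 1) :
    l - m ∈ D.L0 := by
  obtain ⟨a, ha⟩ := hl'
  obtain ⟨b, hb⟩ := hm'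
  exact ⟨D.L.sub_mem hl hm, a - b, by rw [D.B_sub_right, ha, hb]; push_cast; ring⟩

theorem two_mul_B_int {x m : V} (hx : x ∈ D.dual (D.L0 : Set V)) (hm : m ∈ D.L) :
    ∃ n : ℤ, 2 * D.B x m = n := by
  obtain ⟨k, hk⟩ := D.W_dual m hm
  have h : m + m ∈ D.L0 := ⟨D.L.add_mem hm hm, k, by rw [D.B_add_right, hk]; ring⟩
  obtain ⟨n, hn⟩ := hx _ h
  exact ⟨n, by rw [← hn, D.B_add_right]; ring⟩

theorem disc0Proj_eq_iff {x y : ↥(D.dual (D.L0 : Set V))} :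
    D.disc0Proj x = D.disc0Proj y ↔ (x : V) - y ∈ D.L0 := by
  change (QuotientAddGroup.mk x : D.disc0) = QuotientAddGroup.mk y ↔ _
  rw [QuotientAddGroup.eq_iff_sub_mem, AddSubgroup.mem_addSubgroupOf]
  rfl

theorem W_mem_L (huni : D.dual (D.L : Set V) = D.L.toAddSubgroup) : D.W ∈ D.L := by
  have h : D.W ∈ D.dual (D.L : Set V) := D.W_dual
  rwa [huni] at h

end LatticeDatum

/-- The map `x ↦ (x, B₁(x, μ) W₂)`. -/
def stabilizationHom {V₁ V₂ : Type*} [AddCommGroup V₁] [Module ℚ V₁]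
    [AddCommGroup V₂] [Module ℚ V₂] (D₁ : LatticeDatum V₁) (D₂ : LatticeDatum V₂) (μ : V₁) :
    V₁ →+ V₁ × V₂ where
  toFun x := (x, D₁.B x μ • D₂.W)
  map_zero' := by rw [D₁.B_zero_left, zero_smul]; rfl
  map_add' x y := by rw [D₁.B_add_left, add_smul]; rfl

section Stabilization

variable {V₁ V₂ : Type*} [AddCommGroup V₁] [Module ℚ V₁] [AddCommGroup V₂] [Module ℚ V₂]
  {D₁ : LatticeDatum V₁} {D₂ : LatticeDatum V₂} {D : LatticeDatum (V₁ × V₂)}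

theorem mem_L0_prod_iff
    (hB : ∀ x y : V₁ × V₂, D.B x y = D₁.B x.1 y.1 + D₂.B x.2 y.2)
    (hL : D.L = D₁.L.prod D₂.L) (hW : D.W = (D₁.W, D₂.W)) {x : V₁} {v : V₂} :
    (x, v) ∈ D.L0 ↔ x ∈ D₁.L ∧ v ∈ D₂.L ∧ ∃ n : ℤ, D₁.B D₁.W x + D₂.B D₂.W v = 2 * n := by
  rw [D.mem_L0, hL, Submodule.mem_prod, hW, hB, and_assoc]

theorem int_smul_W_mem_L (huni : D₂.dual (D₂.L : Set V₂) = D₂.L.toAddSubgroup) {c : ℚ}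
    (hc : ∃ n : ℤ, c = n) : c • D₂.W ∈ D₂.L := by
  obtain ⟨n, rfl⟩ := hc
  rw [Int.cast_smul_eq_zsmul]
  exact D₂.L.smul_mem n (D₂.W_mem_L huni)

theorem stabilizationHom_mem_dual
    (hB : ∀ x y : V₁ × V₂, D.B x y = D₁.B x.1 y.1 + D₂.B x.2 y.2)
    (hL : D.L = D₁.L.prod D₂.L) (hW : D.W = (D₁.W, D₂.W))
    {μ : V₁} (hμ : μ ∈ D₁.L) (hμ0 : μ ∉ D₁.L0) {x : V₁} (hx : x ∈ D₁.dual (D₁.L0 : Set V₁)) :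
    stabilizationHom D₁ D₂ μ x ∈ D.dual (D.L0 : Set (V₁ × V₂)) := by
  rintro ⟨l, u⟩ hlu
  obtain ⟨hl, hu, n, hn⟩ := (mem_L0_prod_iff hB hL hW).1 hlu
  obtain ⟨k, hk⟩ := D₁.two_mul_B_int hx hμ
  have hval : D.B (stabilizationHom D₁ D₂ μ x) (l, u)
      = D₁.B x l + D₁.B x μ * D₂.B D₂.W u := by
    rw [hB, ← D₂.B_smul_left]; rfl
  rw [hval]
  obtain ⟨a, ha⟩ | ⟨a, ha⟩ := D₂.even_or_odd_B_W hu
  · obtain ⟨m, hm⟩ := hx l ⟨hl, n - a, by push_cast; linarith⟩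
    exact ⟨m + k * a, by rw [hm, ha]; push_cast; rw [← hk]; ring⟩
  · obtain ⟨m, hm⟩ := hx _ (D₁.sub_mem_L0_of_odd hl hμ
      ⟨n - a - 1, by push_cast; linarith⟩ (D₁.odd_B_W_of_notMem_L0 hμ hμ0))
    rw [D₁.B_sub_right] at hm
    refine ⟨m + k * (a + 1), ?_⟩
    rw [ha]; push_cast; rw [← hk, ← hm]; ring

theorem stabilizationHom_mem_L0_iff
    (hB : ∀ x y : V₁ × V₂, D.B x y = D₁.B x.1 y.1 + D₂.B x.2 y.2)
    (hL : D.L = D₁.L.prod D₂.L) (hW : D.W = (D₁.W, D₂.W))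
    (huni : D₂.dual (D₂.L : Set V₂) = D₂.L.toAddSubgroup)
    (h8 : ∃ n : ℤ, D₂.B D₂.W D₂.W = 8 * (n : ℚ))
    {μ : V₁} (hμ : μ ∈ D₁.L) {x : V₁} :
    stabilizationHom D₁ D₂ μ x ∈ D.L0 ↔ x ∈ D₁.L0 := by
  obtain ⟨n, hn⟩ := h8
  change (x, D₁.B x μ • D₂.W) ∈ D.L0 ↔ _
  rw [mem_L0_prod_iff hB hL hW, D₂.B_smul_right, hn]
  constructor
  · rintro ⟨hx, -, a, ha⟩
    obtain ⟨m, hm⟩ := D₁.L_int x hx μ hμ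
    rw [hm] at ha
    exact ⟨hx, a - 4 * m * n, by push_cast; linarith⟩
  · rintro ⟨hx, a, ha⟩
    obtain ⟨m, hm⟩ := D₁.L_int x hx μ hμ
    exact ⟨hx, int_smul_W_mem_L huni ⟨m, hm⟩, a + 4 * m * n, by
      rw [ha, hm]; push_cast; ring⟩

theorem exists_stabilizationHom_sub_mem_L0
    (hB : ∀ x y : V₁ × V₂, D.B x y = D₁.B x.1 y.1 + D₂.B x.2 y.2)
    (hL : D.L = D₁.L.prod D₂.L) (hW : D.W = (D₁.W, D₂.W))
    (huni : D₂.dual (D₂.L : Set V₂) = D₂.L.toAddSubgroup)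
    (h8 : ∃ n : ℤ, D₂.B D₂.W D₂.W = 8 * (n : ℚ))
    {μ : V₁} (hμ : μ ∈ D₁.L) (hμ0 : μ ∉ D₁.L0) {z : V₁ × V₂}
    (hz : z ∈ D.dual (D.L0 : Set (V₁ × V₂))) :
    ∃ x ∈ D₁.dual (D₁.L0 : Set V₁), stabilizationHom D₁ D₂ μ x - z ∈ D.L0 := by
  obtain ⟨y, v⟩ := z
  obtain ⟨n, hn⟩ := h8
  obtain ⟨b, hb⟩ := D₁.odd_B_W_of_notMem_L0 hμ hμ0
  have hpair : ∀ l u, (l, u) ∈ D.L0 → ∃ n : ℤ, D₁.B y l + D₂.B v u = n := fun l u h => by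
    simpa only [hB] using hz (l, u) h
  have hy : y ∈ D₁.dual (D₁.L0 : Set V₁) := fun l hl => by
    obtain ⟨m, hm⟩ := hpair l 0 ((mem_L0_prod_iff hB hL hW).2
      ⟨hl.1, D₂.L.zero_mem, by rw [D₂.B_zero_right, add_zero]; exact hl.2⟩)
    exact ⟨m, by rwa [D₂.B_zero_right, add_zero] at hm⟩
  obtain ⟨k, hk⟩ := D₁.two_mul_B_int hy hμ
  have hw : D₁.B y μ • D₂.W - v ∈ D₂.L := by
    suffices h : D₁.B y μ • D₂.W - v ∈ D₂.dual (D₂.L : Set V₂) by rwa [huni] at h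
    intro u hu
    rw [D₂.B_sub_left, D₂.B_smul_left]
    obtain ⟨a, ha⟩ | ⟨a, ha⟩ := D₂.even_or_odd_B_W hu
    · obtain ⟨m, hm⟩ := hpair 0 u ((mem_L0_prod_iff hB hL hW).2
        ⟨D₁.L.zero_mem, hu, a, by rw [D₁.B_zero_right, zero_add, ha]⟩)
      rw [D₁.B_zero_right, zero_add] at hm
      exact ⟨k * a - m, by rw [ha, hm]; push_cast; rw [← hk]; ring⟩
    · obtain ⟨m, hm⟩ := hpair μ u ((mem_L0_prod_iff hB hL hW).2
        ⟨hμ, hu, a + b + 1, by rw [hb, ha]; push_cast; ring⟩)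
      exact ⟨k * (a + 1) - m, by rw [ha]; push_cast; rw [← hk, ← hm]; ring⟩
  have hφ : stabilizationHom D₁ D₂ μ y - (y, v) = (0, D₁.B y μ • D₂.W - v) :=
    Prod.ext (sub_self y) rfl
  obtain ⟨a, ha⟩ | ⟨a, ha⟩ := D₂.even_or_odd_B_W hw
  · refine ⟨y, hy, ?_⟩
    rw [hφ, mem_L0_prod_iff hB hL hW]
    exact ⟨D₁.L.zero_mem, hw, a, by rw [D₁.B_zero_right, zero_add, ha]⟩
  · refine ⟨y - μ, AddSubgroup.sub_mem _ hy (D₁.L_subset_dual_L0 hμ), ?_⟩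
    obtain ⟨m, hm⟩ := D₁.L_int μ hμ μ hμ
    have hφ' : stabilizationHom D₁ D₂ μ (y - μ) - (y, v)
        = (0 - μ, D₁.B y μ • D₂.W - v - D₁.B μ μ • D₂.W) := by
      rw [map_sub, sub_right_comm, hφ]; rfl
    rw [hφ', mem_L0_prod_iff hB hL hW]
    refine ⟨D₁.L.sub_mem D₁.L.zero_mem hμ,
      D₂.L.sub_mem hw (int_smul_W_mem_L huni ⟨m, hm⟩), a - b - 4 * m * n, ?_⟩
    rw [D₁.B_sub_right, D₁.B_zero_right, D₂.B_sub_right, D₂.B_smul_right, ha, hb, hn, hm]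
    push_cast; ring

end Stabilization

/-- Stabilization by a unimodular lattice: if `(V₁,B₁,Λ',W₂')` and
`(V₂,B₂,U,W₂ᵁ)` are lattice data, `U` is unimodular, `B₂(W₂ᵁ,W₂ᵁ) ∈ 8ℤ`, and
`Λ'₀ ≠ Λ'`, then for the orthogonal direct sum datum `Λ = Λ' ⊕ U` in `V₁ × V₂` (with
`B = B₁ ⊕ B₂`, `W₂ = W₂' + W₂ᵁ`) there is a group isomorphism
`(Λ₀)*/Λ₀ ≅ (Λ'₀)*/Λ'₀` intertwining the quadratic forms `[x] ↦ ½B(x,x)` and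
`[x'] ↦ ½B₁(x',x')` and matching the fermion classes. -/
theorem statement16 {V₁ V₂ : Type*}
    [AddCommGroup V₁] [Module ℚ V₁] [FiniteDimensional ℚ V₁]
    [AddCommGroup V₂] [Module ℚ V₂] [FiniteDimensional ℚ V₂]
    (D₁ : LatticeDatum V₁) (D₂ : LatticeDatum V₂)
    (huni : D₂.dual (D₂.L : Set V₂) = D₂.L.toAddSubgroup)
    (h8 : ∃ n : ℤ, D₂.B D₂.W D₂.W = 8 * (n : ℚ))
    (hne : (D₁.L0 : Set V₁) ≠ (D₁.L : Set V₁))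
    (D : LatticeDatum (V₁ × V₂))
    (hB : ∀ x y : V₁ × V₂, D.B x y = D₁.B x.1 y.1 + D₂.B x.2 y.2)
    (hL : D.L = D₁.L.prod D₂.L)
    (hW : D.W = (D₁.W, D₂.W))
    (qhat : D.disc0 → QZ)
    (hqhat : ∀ x : ↥(D.dual (D.L0 : Set (V₁ × V₂))),
      qhat (D.disc0Proj x) = (((1/2) * D.B ↑x ↑x : ℚ) : QZ))
    (qhat₁ : D₁.disc0 → QZ)
    (hqhat₁ : ∀ x : ↥(D₁.dual (D₁.L0 : Set V₁)),
      qhat₁ (D₁.disc0Proj x) = (((1/2) * D₁.B ↑x ↑x : ℚ) : QZ)) :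
    ∃ e : D.disc0 ≃+ D₁.disc0,
      (∀ g : D.disc0, qhat₁ (e g) = qhat g)
      ∧ ∀ (μ₁ : V₁) (hμL : μ₁ ∈ D₁.L) (hμ0 : μ₁ ∉ D₁.L0)
          (hμd : μ₁ ∈ D₁.dual (D₁.L0 : Set V₁))
          (hd : ((μ₁, (0 : V₂)) : V₁ × V₂) ∈ D.dual (D.L0 : Set (V₁ × V₂))),
          e (D.disc0Proj ⟨(μ₁, (0 : V₂)), hd⟩) = D₁.disc0Proj ⟨μ₁, hμd⟩ := by
  obtain ⟨μ, hμ, hμ0⟩ : ∃ μ ∈ D₁.L, μ ∉ D₁.L0 := by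
    by_contra! h
    exact hne (Set.Subset.antisymm (fun _ => D₁.L0_le_L) h)
  let φ : ↥(D₁.dual (D₁.L0 : Set V₁)) →+ ↥(D.dual (D.L0 : Set (V₁ × V₂))) :=
    ((stabilizationHom D₁ D₂ μ).comp (AddSubgroup.subtype _)).codRestrict _
      fun x => stabilizationHom_mem_dual hB hL hW hμ hμ0 x.2
  have hφ (x) : (φ x : V₁ × V₂) = stabilizationHom D₁ D₂ μ x := rfl
  let f : D₁.disc0 →+ D.disc0 := QuotientAddGroup.map _ _ φ fun x hx =>
    (stabilizationHom_mem_L0_iff hB hL hW huni h8 hμ).2 hx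
  have hf (x) : f (D₁.disc0Proj x) = D.disc0Proj (φ x) := rfl
  have hsurj₁ : Function.Surjective D₁.disc0Proj := QuotientAddGroup.mk'_surjective _
  have hsurj : Function.Surjective D.disc0Proj := QuotientAddGroup.mk'_surjective _
  have hbij : Function.Bijective f := by
    constructor
    · intro g h hgh
      obtain ⟨x, rfl⟩ := hsurj₁ g
      obtain ⟨y, rfl⟩ := hsurj₁ h
      rw [hf, hf, D.disc0Proj_eq_iff, hφ, hφ, ← map_sub,
        stabilizationHom_mem_L0_iff hB hL hW huni h8 hμ] at hgh
      exact D₁.disc0Proj_eq_iff.2 hgh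
    · intro g
      obtain ⟨z, rfl⟩ := hsurj g
      obtain ⟨x, hx, hxz⟩ := exists_stabilizationHom_sub_mem_L0 hB hL hW huni h8 hμ hμ0 z.2
      exact ⟨D₁.disc0Proj ⟨x, hx⟩, D.disc0Proj_eq_iff.2 hxz⟩
  refine ⟨(AddEquiv.ofBijective f hbij).symm, fun g => ?_, fun μ₁ hμL _ hμd hd => ?_⟩
  · obtain ⟨g, rfl⟩ := (AddEquiv.ofBijective f hbij).surjective g
    rw [AddEquiv.symm_apply_apply]
    obtain ⟨x, rfl⟩ := hsurj₁ g
    change _ = qhat (D.disc0Proj (φ x))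
    obtain ⟨n, hn⟩ := h8
    obtain ⟨k, hk⟩ := D₁.two_mul_B_int x.2 hμ
    have hval : D.B (φ x) (φ x)
        = D₁.B x x + D₁.B x μ * (D₁.B x μ * D₂.B D₂.W D₂.W) := by
      rw [hB, ← D₂.B_smul_right, ← D₂.B_smul_left]; rfl
    rw [hqhat, hqhat₁, hval, hn, eq_comm, ← sub_eq_zero, ← AddCircle.coe_sub,
      AddCircle.coe_eq_zero_iff]
    refine ⟨n * k ^ 2, ?_⟩
    rw [zsmul_eq_mul]
    push_cast
    rw [← hk]
    ring
  · rw [AddEquiv.symm_apply_eq]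
    change _ = D.disc0Proj (φ _)
    obtain ⟨n, hn⟩ := h8
    obtain ⟨m, hm⟩ := D₁.L_int μ₁ hμL μ hμ
    have hφ₁ : (φ ⟨μ₁, hμd⟩ : V₁ × V₂) - (μ₁, 0) = (0, D₁.B μ₁ μ • D₂.W) :=
      Prod.ext (sub_self μ₁) (sub_zero _)
    rw [eq_comm, D.disc0Proj_eq_iff, hφ₁, mem_L0_prod_iff hB hL hW]
    refine ⟨D₁.L.zero_mem, int_smul_W_mem_L huni ⟨m, hm⟩, 4 * m * n, ?_⟩
    rw [D₁.B_zero_right, D₂.B_smul_right, hm, hn]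
    push_cast; ring
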